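/- arXiv:1008.5141 — 2 statements merged into one kernel-verified Lean document; each statement's English description precedes it below -/
import Mathlib

section
/- Let (M,d) be a cone metric space over a real Banach space E with cone P, where P is normal with normal constant K. Then a sequence (xₙ) in M is Cauchy (in the cone-metric sense) if and only if ‖d(xₙ,xₘ)‖ → 0 as n, m → ∞ (i.e., for every ε > 0 there is n₀ such that ‖d(xₙ,xₘ)‖ < ε for all n, m ≥ n₀). -/
/-- `P` is a cone in the real Banach space `E`. -/
def IsCone {E : Type*} [NormedAddCommGroup E] [NormedSpace ℝ E] (P : Set E) : Prop :=
  IsClosed P ∧ P.Nonempty ∧ P ≠ {0} ∧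
    (∀ a b : ℝ, 0 ≤ a → 0 ≤ b → ∀ x ∈ P, ∀ y ∈ P, a • x + b • y ∈ P) ∧
    P ∩ (-P) = {0}

/-- The partial order induced by the cone `P`: `x ≤ y` iff `y - x ∈ P`. -/
def ConeLe {E : Type*} [NormedAddCommGroup E] [NormedSpace ℝ E] (P : Set E) (x y : E) : Prop :=
  y - x ∈ P

/-- `x ≪ y` iff `y - x ∈ interior P`. -/
def ConeLt {E : Type*} [NormedAddCommGroup E] [NormedSpace ℝ E] (P : Set E) (x y : E) : Prop :=
  y - x ∈ interior P

/-- `P` is a normal cone with normal constant `K`. -/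
def IsNormalCone {E : Type*} [NormedAddCommGroup E] [NormedSpace ℝ E] (P : Set E) (K : ℝ) : Prop :=
  0 < K ∧ ∀ x y : E, ConeLe P 0 x → ConeLe P x y → ‖x‖ ≤ K * ‖y‖

/-- `d` is a cone metric on `M` with respect to the cone `P`. -/
def IsConeMetric {E M : Type*} [NormedAddCommGroup E] [NormedSpace ℝ E]
    (P : Set E) (d : M → M → E) : Prop :=
  (∀ x y : M, ConeLe P 0 (d x y)) ∧
  (∀ x y : M, d x y = 0 ↔ x = y) ∧
  (∀ x y : M, d x y = d y x) ∧
  (∀ x y z : M, ConeLe P (d x y) (d x z + d z y))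

/-- Convergence of a sequence in a cone metric space. -/
def ConeConv {E M : Type*} [NormedAddCommGroup E] [NormedSpace ℝ E]
    (P : Set E) (d : M → M → E) (u : ℕ → M) (x : M) : Prop :=
  ∀ c : E, ConeLt P 0 c → ∃ n₀ : ℕ, ∀ n ≥ n₀, ConeLt P (d (u n) x) c

/-- Cauchy sequences in a cone metric space. -/
def ConeCauchy {E M : Type*} [NormedAddCommGroup E] [NormedSpace ℝ E]
    (P : Set E) (d : M → M → E) (u : ℕ → M) : Prop :=
  ∀ c : E, ConeLt P 0 c → ∃ n₀ : ℕ, ∀ n ≥ n₀, ∀ m ≥ n₀, ConeLt P (d (u n) (u m)) c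

/-- Completeness of a cone metric space. -/
def ConeComplete {E M : Type*} [NormedAddCommGroup E] [NormedSpace ℝ E]
    (P : Set E) (d : M → M → E) : Prop :=
  ∀ u : ℕ → M, ConeCauchy P d u → ∃ x : M, ConeConv P d u x

/-- Sequential continuity of a self-map of a cone metric space. -/
def ConeSeqContinuous {E M : Type*} [NormedAddCommGroup E] [NormedSpace ℝ E]
    (P : Set E) (d : M → M → E) (T : M → M) : Prop :=
  ∀ (u : ℕ → M) (x : M), ConeConv P d u x → ConeConv P d (fun n => T (u n)) (T x)

/-- `(S, T)` is a pair of generalized Zamfirescu operators with constants `a`, `b`, `c`. -/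
def IsGZO {E M : Type*} [NormedAddCommGroup E] [NormedSpace ℝ E]
    (P : Set E) (d : M → M → E) (S T : M → M) (a b c : ℝ) : Prop :=
  0 ≤ a ∧ a < 1 ∧ 0 ≤ b ∧ b < 1/2 ∧ 0 ≤ c ∧ c < 1/2 ∧
    ∀ x y : M,
      ConeLe P (d (S x) (S y)) (a • d (T x) (T y)) ∨
      ConeLe P (d (S x) (S y)) (b • (d (S x) (T x) + d (S y) (T y))) ∨
      ConeLe P (d (S x) (S y)) (c • (d (S x) (T y) + d (S y) (T x)))

/-- `(S, T)` is a generalized weak contraction. -/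
def IsGWC {E M : Type*} [NormedAddCommGroup E] [NormedSpace ℝ E]
    (P : Set E) (d : M → M → E) (S T : M → M) : Prop :=
  ∃ δ L : ℝ, 0 < δ ∧ δ < 1 ∧ 0 ≤ L ∧
    ∀ x y : M, ConeLe P (d (S x) (S y)) (δ • d (T x) (T y) + L • d (S x) (T x))

open scoped Pointwise in
/-- The interior of a cone is stable under multiplication by positive scalars. -/
theorem IsCone.smul_mem_interior {E : Type*} [NormedAddCommGroup E] [NormedSpace ℝ E]
    {P : Set E} (hP : IsCone P) {t : ℝ} (ht : 0 < t) {e : E} (he : e ∈ interior P) :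
    t • e ∈ interior P := by
  obtain ⟨-, -, -, hcomb, -⟩ := hP
  have hsub : t • P ⊆ P := by
    rintro _ ⟨x, hx, rfl⟩
    simpa using hcomb t 0 ht.le le_rfl x hx x hx
  apply interior_mono hsub
  rw [interior_smul₀ ht.ne']
  exact Set.smul_mem_smul_set he

/-- In a cone metric space over a normal cone, a sequence is Cauchy iff
‖d(xₙ,xₘ)‖ → 0 as n, m → ∞. -/
theorem coneCauchy_iff_norm {E M : Type*} [NormedAddCommGroup E] [NormedSpace ℝ E]
    [CompleteSpace E] [Nonempty M]
    (P : Set E) (K : ℝ) (d : M → M → E)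
    (hP : IsCone P) (hint : (interior P).Nonempty) (hK : IsNormalCone P K)
    (hd : IsConeMetric P d) (u : ℕ → M) :
    ConeCauchy P d u ↔
      ∀ ε : ℝ, 0 < ε → ∃ n₀ : ℕ, ∀ n ≥ n₀, ∀ m ≥ n₀, ‖d (u n) (u m)‖ < ε := by
  obtain ⟨hKpos, hnormal⟩ := hK
  constructor
  · intro hu ε hε
    obtain ⟨e, he⟩ := hint
    have hden : 0 < K * (‖e‖ + 1) := by positivity
    have ht : 0 < ε / (K * (‖e‖ + 1)) := div_pos hε hden
    obtain ⟨n₀, hn₀⟩ := hu ((ε / (K * (‖e‖ + 1))) • e)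
      (by simpa [ConeLt] using hP.smul_mem_interior ht he)
    refine ⟨n₀, fun n hn m hm => ?_⟩
    calc ‖d (u n) (u m)‖ ≤ K * ‖(ε / (K * (‖e‖ + 1))) • e‖ :=
          hnormal _ _ (hd.1 _ _) (interior_subset (hn₀ n hn m hm))
      _ = ε / (K * (‖e‖ + 1)) * (K * ‖e‖) := by
          rw [norm_smul, Real.norm_of_nonneg ht.le]; ring
      _ < ε / (K * (‖e‖ + 1)) * (K * (‖e‖ + 1)) := by gcongr; linarith
      _ = ε := div_mul_cancel₀ _ hden.ne'
  · intro hu c hc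
    have hc' : c ∈ interior P := by simpa [ConeLt] using hc
    obtain ⟨r, hr, hball⟩ := Metric.isOpen_iff.mp isOpen_interior c hc'
    obtain ⟨n₀, hn₀⟩ := hu r hr
    refine ⟨n₀, fun n hn m hm => hball ?_⟩
    simpa [dist_eq_norm] using hn₀ n hn m hm
end

section
/- Let (M,d) be a complete cone metric space over a real Banach space E with cone P, where P is normal with normal constant K. Let S and T be self-maps of M such that (a) T is sequentially continuous, (b) S(M) ⊆ T(M), (c) S and T commute, and (d) d(Sx,Sy) ≤ a·d(Tx,Ty) + b·[d(Sx,Tx) + d(Sy,Ty)] + c·[d(Sx,Ty) + d(Sy,Tx)] for all x, y ∈ M, where a, b, c are nonnegative real numbers with 0 < a + 2b + 2c < 1. Then S and T have a unique common fixed point, i.e., there is exactly one z ∈ M with Sz = z and Tz = z. -/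
open Filter Topology Pointwise

section ConeDual

variable {E : Type*} [NormedAddCommGroup E] [NormedSpace ℝ E] {P : Set E}

/-- A continuous linear functional that is nonnegative on `P`. -/
def IsConePositive (P : Set E) (f : E →L[ℝ] ℝ) : Prop :=
  ∀ x ∈ P, 0 ≤ f x

theorem IsCone.zero_mem (hP : IsCone P) : (0 : E) ∈ P := by
  obtain ⟨-, ⟨x, hx⟩, -, hadd, -⟩ := hP
  simpa using hadd 0 0 le_rfl le_rfl x hx x hx

theorem IsCone.add_mem (hP : IsCone P) {x y : E} (hx : x ∈ P) (hy : y ∈ P) : x + y ∈ P := by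
  simpa using hP.2.2.2.1 1 1 zero_le_one zero_le_one x hx y hy

theorem IsCone.smul_mem (hP : IsCone P) {r : ℝ} (hr : 0 ≤ r) {x : E} (hx : x ∈ P) :
    r • x ∈ P := by
  simpa using hP.2.2.2.1 r 0 hr le_rfl x hx x hx

theorem IsCone.convex (hP : IsCone P) : Convex ℝ P :=
  fun x hx y hy a b ha hb _ => hP.2.2.2.1 a b ha hb x hx y hy

theorem IsCone.add_mem_interior (hP : IsCone P) {x y : E} (hx : x ∈ interior P) (hy : y ∈ P) :
    x + y ∈ interior P := by
  have hopen : IsOpen ((fun z => z - y) ⁻¹' interior P) :=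
    isOpen_interior.preimage (by fun_prop)
  refine interior_maximal (fun z hz => ?_) hopen (by simpa using hx)
  simpa using hP.add_mem (interior_subset hz) hy

/-- By Hahn–Banach, membership in a cone is detected by the positive functionals. -/
theorem IsCone.mem_of_forall_nonneg (hP : IsCone P) {x : E}
    (h : ∀ f : E →L[ℝ] ℝ, IsConePositive P f → 0 ≤ f x) : x ∈ P := by
  by_contra hx
  obtain ⟨f, u, hfx, hu⟩ := geometric_hahn_banach_point_closed hP.convex hP.1 hx
  have hu0 : u < 0 := by simpa using hu 0 hP.zero_mem
  refine absurd (h f fun y hy => ?_) (by linarith)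
  by_contra! hneg
  have hr : 0 ≤ u / f y := (div_pos_of_neg_of_neg hu0 hneg).le
  have := hu _ (hP.smul_mem hr hy)
  rw [map_smul, smul_eq_mul, div_mul_cancel₀ _ hneg.ne] at this
  exact lt_irrefl _ this

theorem IsCone.eq_zero_of_forall_eq_zero (hP : IsCone P) {x : E}
    (h : ∀ f : E →L[ℝ] ℝ, IsConePositive P f → f x = 0) : x = 0 := by
  have hx : x ∈ P ∩ -P :=
    ⟨hP.mem_of_forall_nonneg fun f hf => (h f hf).ge,
      hP.mem_of_forall_nonneg fun f hf => by simp [h f hf]⟩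
  simpa [hP.2.2.2.2] using hx

theorem IsConePositive.map_le {f : E →L[ℝ] ℝ} (hf : IsConePositive P f) {x y : E}
    (h : ConeLe P x y) : f x ≤ f y := by
  simpa using hf _ h

end ConeDual

section ConeMetric

variable {E M : Type*} [NormedAddCommGroup E] [NormedSpace ℝ E] {P : Set E} {d : M → M → E}

theorem IsConeMetric.map_nonneg (hd : IsConeMetric P d) {f : E →L[ℝ] ℝ} (hf : IsConePositive P f)
    (x y : M) : 0 ≤ f (d x y) := by
  simpa using hf.map_le (hd.1 x y)

theorem IsConeMetric.self (hd : IsConeMetric P d) (x : M) : d x x = 0 :=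
  (hd.2.1 x x).2 rfl

theorem IsConeMetric.comm (hd : IsConeMetric P d) (x y : M) : d x y = d y x :=
  hd.2.2.1 x y

theorem IsConeMetric.map_triangle (hd : IsConeMetric P d) {f : E →L[ℝ] ℝ}
    (hf : IsConePositive P f) (x y z : M) : f (d x y) ≤ f (d x z) + f (d z y) := by
  simpa using hf.map_le (hd.2.2.2 x y z)

theorem IsConeMetric.eq_of_map_le_mul (hP : IsCone P) (hd : IsConeMetric P d) {x y : M} {r : ℝ}
    (hr : r < 1)
    (h : ∀ f : E →L[ℝ] ℝ, IsConePositive P f → f (d x y) ≤ r * f (d x y)) : x = y := by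
  refine (hd.2.1 x y).1 (hP.eq_zero_of_forall_eq_zero fun f hf => ?_)
  have := h f hf
  have := hd.map_nonneg hf x y
  nlinarith

theorem ConeConv.tendsto_map (hP : IsCone P) (hint : (interior P).Nonempty)
    (hd : IsConeMetric P d) {u : ℕ → M} {x : M} (hu : ConeConv P d u x)
    {f : E →L[ℝ] ℝ} (hf : IsConePositive P f) :
    Tendsto (fun n => f (d (u n) x)) atTop (𝓝 0) := by
  obtain ⟨e, he⟩ := hint
  have hfe : 0 ≤ f e := hf e (interior_subset he)
  rw [Metric.tendsto_atTop]
  intro ε hε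
  set r : ℝ := ε / (f e + 1)
  have hr : 0 < r := by positivity
  have hre : r • e ∈ interior P := by
    have hsub : r • interior P ⊆ P := by
      rintro _ ⟨y, hy, rfl⟩
      exact hP.smul_mem hr.le (interior_subset hy)
    exact interior_maximal hsub (isOpen_interior.smul₀ hr.ne') (Set.smul_mem_smul_set he)
  obtain ⟨N, hN⟩ := hu (r • e) (by simpa [ConeLt] using hre)
  refine ⟨N, fun n hn => ?_⟩
  have hle : f (d (u n) x) ≤ r * f e := by
    simpa using hf.map_le (show ConeLe P _ _ from interior_subset (hN n hn))
  have hrε : r * (f e + 1) = ε := div_mul_cancel₀ _ (by positivity)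
  rw [Real.dist_eq, sub_zero, abs_of_nonneg (hd.map_nonneg hf _ _)]
  linarith

/-- A sequence whose consecutive distances decay geometrically is Cauchy. -/
theorem IsConeMetric.coneCauchy_of_geometric (hP : IsCone P) (hd : IsConeMetric P d)
    {u : ℕ → M} {k : ℝ} (hk0 : 0 ≤ k) (hk1 : k < 1)
    (h : ∀ f : E →L[ℝ] ℝ, IsConePositive P f → ∀ n,
      f (d (u (n + 1)) (u (n + 2))) ≤ k * f (d (u n) (u (n + 1)))) :
    ConeCauchy P d u := by
  intro c hc
  have hc' : c ∈ interior P := by simpa [ConeLt] using hc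
  set v := d (u 0) (u 1)
  have hlim : Tendsto (fun n : ℕ => c - (2 * k ^ n / (1 - k)) • v) atTop (𝓝 c) := by
    have hpow := ((tendsto_pow_atTop_nhds_zero_of_lt_one hk0 hk1).const_mul 2).div_const (1 - k)
    simpa using (hpow.smul_const v).const_sub c
  obtain ⟨N, hN⟩ := (hlim.eventually (isOpen_interior.mem_nhds hc')).exists
  refine ⟨N, fun n hn m hm => ?_⟩
  have hsum : (2 * k ^ N / (1 - k)) • v - d (u n) (u m) ∈ P := by
    refine hP.mem_of_forall_nonneg fun f hf => ?_
    have hstep : ∀ n, f (d (u n) (u (n + 1))) ≤ k ^ n * f v := by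
      intro n
      induction n with
      | zero => simp [v]
      | succ n ih =>
        calc f (d (u (n + 1)) (u (n + 2))) ≤ k * f (d (u n) (u (n + 1))) := h f hf n
          _ ≤ k * (k ^ n * f v) := by gcongr
          _ = k ^ (n + 1) * f v := by ring
    have hv : 0 ≤ f v := hd.map_nonneg hf _ _
    have hpartial : ∀ j, (1 - k) * f (d (u N) (u (N + j))) ≤ (k ^ N - k ^ (N + j)) * f v := by
      intro j
      induction j with
      | zero => simp [hd.self]
      | succ j ih =>
        have htri := hd.map_triangle hf (u N) (u (N + (j + 1))) (u (N + j))
        have hmul := mul_le_mul_of_nonneg_left (htri.trans (add_le_add_right (hstep (N + j)) _))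
          (sub_nonneg.2 hk1.le)
        calc _ ≤ _ := hmul
          _ ≤ (k ^ N - k ^ (N + j)) * f v + (1 - k) * (k ^ (N + j) * f v) := by linarith
          _ = (k ^ N - k ^ (N + (j + 1))) * f v := by ring
    have htail : ∀ i ≥ N, f (d (u N) (u i)) ≤ k ^ N / (1 - k) * f v := by
      intro i hi
      obtain ⟨j, rfl⟩ := Nat.exists_eq_add_of_le hi
      rw [div_mul_eq_mul_div, le_div_iff₀ (sub_pos.2 hk1)]
      have := hpartial j
      have : 0 ≤ k ^ (N + j) * f v := by positivity
      linarith
    have htri := hd.map_triangle hf (u n) (u m) (u N)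
    rw [hd.comm (u n) (u N)] at htri
    have hn' := htail n hn
    have hm' := htail m hm
    rw [map_sub, map_smul, smul_eq_mul, mul_div_assoc]
    linarith
  have := hP.add_mem_interior hN hsum
  simpa [ConeLt] using this

end ConeMetric

/-- Singh's common fixed point theorem for commuting mappings in a complete cone
metric space. -/
theorem singh_cone_fixed_point {E M : Type*} [NormedAddCommGroup E] [NormedSpace ℝ E]
    [CompleteSpace E] [Nonempty M]
    (P : Set E) (K : ℝ) (d : M → M → E)
    (hP : IsCone P) (hint : (interior P).Nonempty) (hK : IsNormalCone P K)
    (hd : IsConeMetric P d) (hcomp : ConeComplete P d)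
    (S T : M → M) (a b c : ℝ)
    (hT : ConeSeqContinuous P d T)
    (hrange : Set.range S ⊆ Set.range T)
    (hcomm : ∀ x : M, S (T x) = T (S x))
    (ha : 0 ≤ a) (hb : 0 ≤ b) (hc : 0 ≤ c)
    (hpos : 0 < a + 2 * b + 2 * c) (hlt : a + 2 * b + 2 * c < 1)
    (hcontr : ∀ x y : M, ConeLe P (d (S x) (S y))
      (a • d (T x) (T y) + b • (d (S x) (T x) + d (S y) (T y))
        + c • (d (S x) (T y) + d (S y) (T x)))) :
    ∃! z : M, S z = z ∧ T z = z := by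
  have hcontr' : ∀ f : E →L[ℝ] ℝ, IsConePositive P f → ∀ x y, f (d (S x) (S y)) ≤
      a * f (d (T x) (T y)) + b * (f (d (S x) (T x)) + f (d (S y) (T y)))
        + c * (f (d (S x) (T y)) + f (d (S y) (T x))) := fun f hf x y => by
    simpa [mul_add] using hf.map_le (hcontr x y)
  choose g hg using fun x => hrange (Set.mem_range_self x)
  obtain ⟨x₀⟩ := ‹Nonempty M›
  set x : ℕ → M := fun n => g^[n] x₀
  have hx : ∀ n, T (x (n + 1)) = S (x n) := fun n => by
    simp only [x, Function.iterate_succ_apply', hg]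
  have hbc : 0 < 1 - b - c := by linarith
  have hcauchy : ConeCauchy P d fun n => S (x n) := by
    refine hd.coneCauchy_of_geometric hP (k := (a + b + c) / (1 - b - c)) (by positivity)
      ((div_lt_one hbc).2 (by linarith)) fun f hf n => ?_
    have h := hcontr' f hf (x (n + 1)) (x (n + 2))
    have htri := hd.map_triangle hf (S (x n)) (S (x (n + 2))) (S (x (n + 1)))
    rw [hx n, hx (n + 1), hd.self, map_zero, hd.comm (S (x (n + 1))) (S (x n)),
      hd.comm (S (x (n + 2))) (S (x (n + 1))), hd.comm (S (x (n + 2))) (S (x n))] at h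
    rw [div_mul_eq_mul_div, le_div_iff₀ hbc]
    linarith [mul_le_mul_of_nonneg_left htri hc]
  obtain ⟨z, hz⟩ := hcomp _ hcauchy
  have hTz := hT _ _ hz
  have hST : ∀ n, S (S (x n)) = T (S (x (n + 1))) := fun n => by rw [← hx n, hcomm]
  have hcoin : S z = T z := by
    refine hd.eq_of_map_le_mul hP (r := b + c) (by linarith) fun f hf => ?_
    have hlim := hTz.tendsto_map hP hint hd hf
    have hlim' := hlim.comp (tendsto_add_atTop_nat 1)
    set D := f (d (S z) (T z))
    have hbound : ∀ n, D ≤ (b + c) * D + ((a + b + c) * f (d (T (S (x n))) (T z))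
        + (1 + b + c) * f (d (T (S (x (n + 1)))) (T z))) := by
      intro n
      have h := hcontr' f hf z (S (x n))
      rw [hST n] at h
      have h₁ := hd.map_triangle hf (S z) (T z) (T (S (x (n + 1))))
      have h₂ := hd.map_triangle hf (T (S (x (n + 1)))) (T (S (x n))) (T z)
      have h₃ := hd.map_triangle hf (S z) (T (S (x n))) (T z)
      rw [hd.comm (T z) (T (S (x n)))] at h h₂ h₃
      linarith [mul_le_mul_of_nonneg_left h₂ hb, mul_le_mul_of_nonneg_left h₃ hc]
    refine ge_of_tendsto' (x := atTop) ?_ hbound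
    simpa using ((hlim.const_mul (a + b + c)).add (hlim'.const_mul (1 + b + c))).const_add
      ((b + c) * D)
  have heq : ∀ p q, S p = T p → S q = T q → S p = S q := fun p q hp hq => by
    refine hd.eq_of_map_le_mul hP (r := a + 2 * c) (by linarith) fun f hf => ?_
    have h := hcontr' f hf p q
    rw [← hp, ← hq, hd.self, hd.self, map_zero, hd.comm (S q) (S p)] at h
    linarith
  have hcoin' : S (S z) = T (S z) := by rw [← hcomm, ← hcoin]
  have hfix : S (S z) = S z := heq _ _ hcoin' hcoin
  refine ⟨S z, ⟨hfix, hcoin'.symm.trans hfix⟩, fun w hw => ?_⟩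
  rw [← hw.1]
  exact heq _ _ (hw.1.trans hw.2.symm) hcoin
end
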